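/- For every 𝐤 ∈ ℕ²: the polynomial 𝒯_𝐤 maps ℂ into ℂ, and the modulus of 𝒯_𝐤 is independent of the imaginary unit, i.e. |𝒯_𝐤(z+βJ)| = |𝒯_𝐤(z+βK)| for all z ∈ ℂ, β ∈ ℝ and all J, K ∈ S¹. -/

import Mathlib

open Quaternion

noncomputable section

/-- The real quaternions. -/
abbrev H : Type := Quaternion ℝ

/-- The imaginary unit `i`. -/
def qi : H := ⟨0, 1, 0, 0⟩
/-- The imaginary unit `j`. -/
def qj : H := ⟨0, 0, 1, 0⟩
/-- The imaginary unit `k`. -/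
def qk : H := ⟨0, 0, 0, 1⟩

/-- `S¹`: the circle of unit quaternions in the plane `jℝ + kℝ`. -/
def S1 : Set H := {J : H | J.re = 0 ∧ J.imI = 0 ∧ J.imJ ^ 2 + J.imK ^ 2 = 1}

/-- The subset `ℂ = ℝ + iℝ` of `ℍ` (the mirror). -/
def Cset : Set H := {x : H | x.imJ = 0 ∧ x.imK = 0}

/-- `x₁ − (−1)^{k₂}·i·x₀`, as a function of `x ∈ ℍ`. -/
def zA (k2 : ℕ) (x : H) : H := (x.imI : H) - ((-1 : ℝ) ^ k2 * x.re) • qi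

/-- `x₀ + j x₂ + k x₃`, as a function of `x ∈ ℍ`. -/
def zB (x : H) : H := (x.re : H) + x.imJ • qj + x.imK • qk

/-- The polynomials `𝒯_𝐤 : ℍ → ℍ`: `𝒯_{(0,0)} ≡ 1` and, for `𝐤 ≠ (0,0)`,
`|𝐤|·𝒯_𝐤(x) = k₁·𝒯_{(k₁−1,k₂)}(x)·(x₁−(−1)^{k₂}ix₀) + k₂·𝒯_{(k₁,k₂−1)}(x)·(x₀+jx₂+kx₃)`
(terms with a negative index are zero). -/
def T : ℕ → ℕ → H → H
  | 0, 0, _ => 1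
  | k1 + 1, 0, x =>
      ((k1 + 1 : ℝ))⁻¹ • ((k1 + 1 : ℝ) • (T k1 0 x * zA 0 x))
  | 0, k2 + 1, x =>
      ((k2 + 1 : ℝ))⁻¹ • ((k2 + 1 : ℝ) • (T 0 k2 x * zB x))
  | k1 + 1, k2 + 1, x =>
      ((k1 + 1 + (k2 + 1) : ℝ))⁻¹ •
        ((k1 + 1 : ℝ) • (T k1 (k2 + 1) x * zA (k2 + 1) x)
          + (k2 + 1 : ℝ) • (T (k1 + 1) k2 x * zB x))
  termination_by k1 k2 => k1 + k2

/-- At the points `x = x₀ + i x₁ + β J` with `J = c j + s k` unit, `f x` has the form `a + b J` with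
`a`, `b ∈ ℂ` independent of `J`, and `b` vanishes when `β` does. -/
def IsSliceAffine (x₀ x₁ β : ℝ) (f : H → H) : Prop :=
  ∃ a₀ a₁ b₀ b₁ : ℝ, (β = 0 → b₀ = 0 ∧ b₁ = 0) ∧
    ∀ (c s : ℝ) (x : H), c ^ 2 + s ^ 2 = 1 →
      x.re = x₀ → x.imI = x₁ → x.imJ = β * c → x.imK = β * s →
      (f x).re = a₀ ∧ (f x).imI = a₁ ∧
        (f x).imJ = b₀ * c - b₁ * s ∧ (f x).imK = b₀ * s + b₁ * c

@[simp] theorem re_qi : qi.re = 0 := rfl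
@[simp] theorem imI_qi : qi.imI = 1 := rfl
@[simp] theorem imJ_qi : qi.imJ = 0 := rfl
@[simp] theorem imK_qi : qi.imK = 0 := rfl
@[simp] theorem re_qj : qj.re = 0 := rfl
@[simp] theorem imI_qj : qj.imI = 0 := rfl
@[simp] theorem imJ_qj : qj.imJ = 1 := rfl
@[simp] theorem imK_qj : qj.imK = 0 := rfl
@[simp] theorem re_qk : qk.re = 0 := rfl
@[simp] theorem imI_qk : qk.imI = 0 := rfl
@[simp] theorem imJ_qk : qk.imJ = 0 := rfl
@[simp] theorem imK_qk : qk.imK = 1 := rfl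

theorem zA_components (n : ℕ) (x : H) :
    (zA n x).re = x.imI ∧ (zA n x).imI = -((-1) ^ n * x.re) ∧
      (zA n x).imJ = 0 ∧ (zA n x).imK = 0 := by
  refine ⟨?_, ?_, ?_, ?_⟩ <;> simp [zA]

theorem zB_components (x : H) :
    (zB x).re = x.re ∧ (zB x).imI = 0 ∧ (zB x).imJ = x.imJ ∧ (zB x).imK = x.imK := by
  refine ⟨?_, ?_, ?_, ?_⟩ <;> simp [zB]

namespace IsSliceAffine

variable {x₀ x₁ β : ℝ} {f g : H → H}

theorem one : IsSliceAffine x₀ x₁ β fun _ => 1 :=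
  ⟨1, 0, 0, 0, by simp, fun c s x _ _ _ _ _ => by simp⟩

theorem add (hf : IsSliceAffine x₀ x₁ β f) (hg : IsSliceAffine x₀ x₁ β g) :
    IsSliceAffine x₀ x₁ β fun x => f x + g x := by
  obtain ⟨a₀, a₁, b₀, b₁, hb, hf⟩ := hf
  obtain ⟨a₀', a₁', b₀', b₁', hb', hg⟩ := hg
  refine ⟨a₀ + a₀', a₁ + a₁', b₀ + b₀', b₁ + b₁', fun h => ?_, fun c s x h h₀ h₁ h₂ h₃ => ?_⟩
  · simp [hb h, hb' h]
  · obtain ⟨e₀, e₁, e₂, e₃⟩ := hf c s x h h₀ h₁ h₂ h₃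
    obtain ⟨e₀', e₁', e₂', e₃'⟩ := hg c s x h h₀ h₁ h₂ h₃
    simp only [Quaternion.re_add, Quaternion.imI_add, Quaternion.imJ_add, Quaternion.imK_add,
      e₀, e₁, e₂, e₃, e₀', e₁', e₂', e₃']
    exact ⟨trivial, trivial, by ring, by ring⟩

theorem smul (r : ℝ) (hf : IsSliceAffine x₀ x₁ β f) :
    IsSliceAffine x₀ x₁ β fun x => r • f x := by
  obtain ⟨a₀, a₁, b₀, b₁, hb, hf⟩ := hf
  refine ⟨r * a₀, r * a₁, r * b₀, r * b₁, fun h => ?_, fun c s x h h₀ h₁ h₂ h₃ => ?_⟩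
  · simp [hb h]
  · obtain ⟨e₀, e₁, e₂, e₃⟩ := hf c s x h h₀ h₁ h₂ h₃
    simp only [Quaternion.re_smul, Quaternion.imI_smul, Quaternion.imJ_smul, Quaternion.imK_smul,
      smul_eq_mul, e₀, e₁, e₂, e₃]
    exact ⟨trivial, trivial, by ring, by ring⟩

theorem mul_zA (n : ℕ) (hf : IsSliceAffine x₀ x₁ β f) :
    IsSliceAffine x₀ x₁ β fun x => f x * zA n x := by
  obtain ⟨a₀, a₁, b₀, b₁, hb, hf⟩ := hf
  refine ⟨a₀ * x₁ + a₁ * ((-1) ^ n * x₀), a₁ * x₁ - a₀ * ((-1) ^ n * x₀),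
    b₀ * x₁ + b₁ * -((-1) ^ n * x₀), b₁ * x₁ + b₀ * ((-1) ^ n * x₀),
    fun h => ?_, fun c s x h h₀ h₁ h₂ h₃ => ?_⟩
  · simp [hb h]
  · obtain ⟨e₀, e₁, e₂, e₃⟩ := hf c s x h h₀ h₁ h₂ h₃
    obtain ⟨z₀, z₁, z₂, z₃⟩ := zA_components n x
    simp only [Quaternion.re_mul, Quaternion.imI_mul, Quaternion.imJ_mul, Quaternion.imK_mul,
      e₀, e₁, e₂, e₃, z₀, z₁, z₂, z₃, h₀, h₁]
    refine ⟨?_, ?_, ?_, ?_⟩ <;> ring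

theorem mul_zB (hf : IsSliceAffine x₀ x₁ β f) :
    IsSliceAffine x₀ x₁ β fun x => f x * zB x := by
  obtain ⟨a₀, a₁, b₀, b₁, hb, hf⟩ := hf
  refine ⟨a₀ * x₀ - b₀ * β, a₁ * x₀ - b₁ * β, a₀ * β + b₀ * x₀, a₁ * β + b₁ * x₀,
    fun h => ?_, fun c s x h h₀ h₁ h₂ h₃ => ?_⟩
  · simp [hb h, h]
  · obtain ⟨e₀, e₁, e₂, e₃⟩ := hf c s x h h₀ h₁ h₂ h₃
    obtain ⟨z₀, z₁, z₂, z₃⟩ := zB_components x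
    simp only [Quaternion.re_mul, Quaternion.imI_mul, Quaternion.imJ_mul, Quaternion.imK_mul,
      e₀, e₁, e₂, e₃, z₀, z₁, z₂, z₃, h₀, h₂, h₃]
    refine ⟨?_, ?_, ?_, ?_⟩
    · linear_combination (-b₀ * β) * h
    · linear_combination (-b₁ * β) * h
    · ring
    · ring

end IsSliceAffine

theorem isSliceAffine_T (x₀ x₁ β : ℝ) : ∀ k1 k2 : ℕ, IsSliceAffine x₀ x₁ β (T k1 k2)
  | 0, 0 => by
    rw [show T 0 0 = fun _ => 1 from funext fun x => by rw [T]]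
    exact .one
  | k1 + 1, 0 => by
    rw [funext fun x => T.eq_2 x k1]
    exact (((isSliceAffine_T x₀ x₁ β k1 0).mul_zA 0).smul _).smul _
  | 0, k2 + 1 => by
    rw [funext fun x => T.eq_3 x k2]
    exact (((isSliceAffine_T x₀ x₁ β 0 k2).mul_zB).smul _).smul _
  | k1 + 1, k2 + 1 => by
    rw [funext fun x => T.eq_4 x k1 k2]
    exact ((((isSliceAffine_T x₀ x₁ β k1 (k2 + 1)).mul_zA (k2 + 1)).smul _).add
      (((isSliceAffine_T x₀ x₁ β (k1 + 1) k2).mul_zB).smul _)).smul _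
  termination_by k1 k2 => k1 + k2

/-- each `𝒯_𝐤` maps `ℂ` into `ℂ`, and the modulus `|𝒯_𝐤(z+βJ)|` does not
depend on the imaginary unit `J ∈ S¹`. -/
theorem stmt14 (k1 k2 : ℕ) :
    (∀ z ∈ Cset, T k1 k2 z ∈ Cset) ∧
    (∀ z ∈ Cset, ∀ β : ℝ, ∀ J ∈ S1, ∀ K ∈ S1,
      ‖T k1 k2 (z + β • J)‖ = ‖T k1 k2 (z + β • K)‖) := by
  refine ⟨fun z hz => ?_, fun z hz β J hJ K hK => ?_⟩
  · obtain ⟨a₀, a₁, b₀, b₁, hb, h⟩ := isSliceAffine_T z.re z.imI 0 k1 k2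
    obtain ⟨rfl, rfl⟩ := hb rfl
    obtain ⟨-, -, e₂, e₃⟩ :=
      h 1 0 z (by norm_num) rfl rfl (by rw [hz.1, zero_mul]) (by rw [hz.2, zero_mul])
    exact ⟨by simpa using e₂, by simpa using e₃⟩
  · obtain ⟨a₀, a₁, b₀, b₁, -, h⟩ := isSliceAffine_T z.re z.imI β k1 k2
    have norm_sq_T : ∀ L ∈ S1, ‖T k1 k2 (z + β • L)‖ ^ 2 = a₀ ^ 2 + a₁ ^ 2 + b₀ ^ 2 + b₁ ^ 2 := by
      rintro L ⟨hL₀, hL₁, hL⟩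
      obtain ⟨e₀, e₁, e₂, e₃⟩ := h L.imJ L.imK (z + β • L) hL
        (by simp [hL₀]) (by simp [hL₁]) (by simp [hz.1]) (by simp [hz.2])
      rw [sq, ← Quaternion.normSq_eq_norm_mul_self, Quaternion.normSq_def', e₀, e₁, e₂, e₃]
      linear_combination (b₀ ^ 2 + b₁ ^ 2) * hL
    exact (sq_eq_sq₀ (norm_nonneg _) (norm_nonneg _)).1
      ((norm_sq_T J hJ).trans (norm_sq_T K hK).symm)
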